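/- Let r, s, k be integers with 0 < r < s < k and let q be a complex number with |q| < 1. Then (−q^{r+k}; q^k)_∞ · ∑_{n=0}^{∞} q^{sn} q^{k n(n+1)/2} / ((q^k; q^k)_n · (−q^{r+k}; q^k)_n) = (−q^{s+k}; q^k)_∞ · ∑_{n=0}^{∞} q^{rn} q^{k n(n+1)/2} / ((q^k; q^k)_n · (−q^{s+k}; q^k)_n). -/

import Mathlib

/-- The finite q-Pochhammer symbol `(a; q)_n = ∏_{j=0}^{n-1} (1 - a q^j)`. -/
noncomputable def qPoch (a q : ℂ) (n : ℕ) : ℂ := ∏ j ∈ Finset.range n, (1 - a * q ^ j)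

/-- The infinite q-Pochhammer symbol `(a; q)_∞ = ∏_{j=0}^{∞} (1 - a q^j)`. -/
noncomputable def qPochInf (a q : ℂ) : ℂ := ∏' j : ℕ, (1 - a * q ^ j)

open Filter Topology

lemma one_sub_pow_succ_ne_zero {p : ℂ} (hp : ‖p‖ < 1) (n : ℕ) : 1 - p ^ (n + 1) ≠ 0 := by
  intro h
  have h1 : ‖p ^ (n + 1)‖ < 1 := by
    rw [norm_pow]; exact pow_lt_one₀ (norm_nonneg _) hp (Nat.succ_ne_zero n)
  rw [← sub_eq_zero.mp h, norm_one] at h1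
  exact lt_irrefl _ h1

lemma qPoch_succ (a p : ℂ) (n : ℕ) : qPoch a p (n + 1) = qPoch a p n * (1 - a * p ^ n) :=
  Finset.prod_range_succ _ _

lemma qPoch_ne_zero {a p : ℂ} (ha : ‖a‖ < 1) (hp : ‖p‖ < 1) (n : ℕ) : qPoch a p n ≠ 0 := by
  refine Finset.prod_ne_zero_iff.mpr fun j _ h => ?_
  have h1 : ‖a * p ^ j‖ < 1 := by
    rw [norm_mul, norm_pow]
    exact mul_lt_one_of_nonneg_of_lt_one_left (norm_nonneg _) ha
      (pow_le_one₀ (norm_nonneg _) hp.le)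
  rw [← sub_eq_zero.mp h, norm_one] at h1
  exact lt_irrefl _ h1

lemma multipliable_one_sub_mul_pow (a : ℂ) {p : ℂ} (hp : ‖p‖ < 1) :
    Multipliable fun j : ℕ => 1 - a * p ^ j := by
  have h : Summable fun j : ℕ => ‖-(a * p ^ j)‖ := by
    simpa using (summable_geometric_of_lt_one (norm_nonneg p) hp).mul_left ‖a‖
  simpa [sub_eq_add_neg] using multipliable_one_add_of_summable h

lemma tendsto_qPoch (a : ℂ) {p : ℂ} (hp : ‖p‖ < 1) :
    Tendsto (qPoch a p) atTop (𝓝 (qPochInf a p)) :=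
  (multipliable_one_sub_mul_pow a hp).hasProd.tendsto_prod_nat

lemma qPoch_add (a p : ℂ) (n m : ℕ) :
    qPoch a p (n + m) = qPoch a p n * qPoch (a * p ^ n) p m := by
  simp only [qPoch, Finset.prod_range_add, pow_add, mul_assoc]

lemma qPochInf_eq_qPoch_mul (a : ℂ) {p : ℂ} (hp : ‖p‖ < 1) (n : ℕ) :
    qPochInf a p = qPoch a p n * qPochInf (a * p ^ n) p := by
  have h1 := (tendsto_qPoch (a * p ^ n) hp).const_mul (qPoch a p n)
  have h2 := (tendsto_qPoch a hp).comp (tendsto_add_atTop_nat n)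
  refine tendsto_nhds_unique h2 (h1.congr fun m => ?_)
  simp [← qPoch_add, add_comm]

/-- The coefficient of `x ^ n` in Euler's expansion of `(-x; p)_∞`. -/
noncomputable def eulerCoeff (p : ℂ) (n : ℕ) : ℂ := p ^ n.choose 2 / qPoch p p n

lemma eulerCoeff_zero (p : ℂ) : eulerCoeff p 0 = 1 := by simp [eulerCoeff, qPoch]

lemma eulerCoeff_succ_mul {p : ℂ} (hp : ‖p‖ < 1) (n : ℕ) :
    eulerCoeff p (n + 1) * (1 - p ^ (n + 1)) = eulerCoeff p n * p ^ n := by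
  have h1 := one_sub_pow_succ_ne_zero hp n
  have h2 := qPoch_ne_zero hp hp n
  have h3 : (n + 1).choose 2 = n + n.choose 2 := by
    rw [Nat.choose_succ_succ' n 1, Nat.choose_one_right]
  rw [eulerCoeff, eulerCoeff, qPoch_succ, ← pow_succ', h3, pow_add]
  field_simp

lemma summable_norm_eulerCoeff {p : ℂ} (hp : ‖p‖ < 1) : Summable fun n => ‖eulerCoeff p n‖ := by
  have h0 : Tendsto (fun n : ℕ => p ^ n / (1 - p ^ (n + 1))) atTop (𝓝 0) := by
    have h := tendsto_pow_atTop_nhds_zero_of_norm_lt_one hp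
    have h' := (h.comp (tendsto_add_atTop_nat 1)).const_sub 1
    have h2 := h.div h' (by simp)
    rwa [zero_div] at h2
  have h1 : ∀ᶠ n : ℕ in atTop, ‖p ^ n / (1 - p ^ (n + 1))‖ < 1 / 2 :=
    h0.norm.eventually_lt_const (by simp)
  refine summable_of_ratio_norm_eventually_le (r := 1 / 2) (by norm_num) ?_
  filter_upwards [h1] with n hn
  have h2 : eulerCoeff p (n + 1) = p ^ n / (1 - p ^ (n + 1)) * eulerCoeff p n := by
    have := one_sub_pow_succ_ne_zero hp n
    field_simp
    linear_combination eulerCoeff_succ_mul hp n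
  rw [norm_norm, norm_norm, h2, norm_mul]
  gcongr

lemma norm_pow_mul_le {x : ℂ} (hx : ‖x‖ ≤ 1) (c : ℂ) (n : ℕ) : ‖x ^ n * c‖ ≤ ‖c‖ := by
  rw [norm_mul, norm_pow]
  exact mul_le_of_le_one_left (norm_nonneg _) (pow_le_one₀ (norm_nonneg _) hx)

lemma summable_pow_mul_eulerCoeff {x p : ℂ} (hx : ‖x‖ ≤ 1) (hp : ‖p‖ < 1) :
    Summable fun n => x ^ n * eulerCoeff p n :=
  .of_norm_bounded (summable_norm_eulerCoeff hp) fun n => norm_pow_mul_le hx _ n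

lemma norm_mul_pow_le_one {x p : ℂ} (hx : ‖x‖ ≤ 1) (hp : ‖p‖ < 1) (n : ℕ) : ‖x * p ^ n‖ ≤ 1 := by
  rw [norm_mul, norm_pow]
  exact mul_le_one₀ hx (by positivity) (pow_le_one₀ (norm_nonneg _) hp.le)

lemma tsum_pow_mul_eulerCoeff_eq {x p : ℂ} (hx : ‖x‖ ≤ 1) (hp : ‖p‖ < 1) :
    ∑' n, x ^ n * eulerCoeff p n = (1 + x) * ∑' n, (x * p) ^ n * eulerCoeff p n := by
  have hxp : ‖x * p‖ ≤ 1 := by simpa using norm_mul_pow_le_one hx hp 1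
  have h1 := summable_pow_mul_eulerCoeff hx hp
  have h2 := summable_pow_mul_eulerCoeff hxp hp
  have h3 : ∑' n, (x ^ n * eulerCoeff p n - (x * p) ^ n * eulerCoeff p n) =
      x * ∑' n, (x * p) ^ n * eulerCoeff p n := by
    rw [(h1.sub h2).tsum_eq_zero_add, ← tsum_mul_left]
    simp only [pow_zero, sub_self, zero_add]
    refine tsum_congr fun n => ?_
    linear_combination x ^ (n + 1) * eulerCoeff_succ_mul hp n
  rw [h1.tsum_sub h2] at h3
  linear_combination h3

lemma tsum_pow_mul_eulerCoeff_eq_qPoch_mul {x p : ℂ} (hx : ‖x‖ ≤ 1) (hp : ‖p‖ < 1) (N : ℕ) :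
    ∑' n, x ^ n * eulerCoeff p n =
      qPoch (-x) p N * ∑' n, (x * p ^ N) ^ n * eulerCoeff p n := by
  induction N with
  | zero => simp [qPoch]
  | succ N ih =>
    rw [ih, tsum_pow_mul_eulerCoeff_eq (norm_mul_pow_le_one hx hp N) hp, qPoch_succ, pow_succ,
      mul_assoc x]
    ring

/-- Euler's expansion of the infinite `q`-Pochhammer symbol. -/
lemma qPochInf_neg_eq_tsum {x p : ℂ} (hx : ‖x‖ ≤ 1) (hp : ‖p‖ < 1) :
    qPochInf (-x) p = ∑' n, x ^ n * eulerCoeff p n := by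
  have h0 : Tendsto (fun N : ℕ => x * p ^ N) atTop (𝓝 0) := by
    simpa using (tendsto_pow_atTop_nhds_zero_of_norm_lt_one hp).const_mul x
  have h1 : Tendsto (fun N : ℕ => ∑' n, (x * p ^ N) ^ n * eulerCoeff p n) atTop
      (𝓝 (∑' n, (0 : ℂ) ^ n * eulerCoeff p n)) :=
    tendsto_tsum_of_dominated_convergence (summable_norm_eulerCoeff hp)
      (fun n => (h0.pow n).mul_const _)
      (Eventually.of_forall fun N n => norm_pow_mul_le (norm_mul_pow_le_one hx hp N) _ n)
  have h2 : ∑' n, (0 : ℂ) ^ n * eulerCoeff p n = 1 := by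
    rw [tsum_eq_single 0 fun n hn => by simp [hn]]
    simp [eulerCoeff_zero]
  rw [h2] at h1
  have h3 := (tendsto_qPoch (-x) hp).mul h1
  rw [mul_one] at h3
  exact tendsto_nhds_unique h3
    (tendsto_const_nhds.congr fun N => tsum_pow_mul_eulerCoeff_eq_qPoch_mul hx hp N)

lemma qPochInf_mul_tsum_eq {a b p : ℂ} (ha : ‖a‖ ≤ 1) (hp : ‖p‖ < 1) :
    qPochInf (-(a * p)) p *
        ∑' n : ℕ, b ^ n * p ^ (n + 1).choose 2 / (qPoch p p n * qPoch (-(a * p)) p n) =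
      ∑' n : ℕ, ∑' m : ℕ, (b * p) ^ n * (a * p) ^ m * p ^ (n * m) *
        (eulerCoeff p n * eulerCoeff p m) := by
  have hap : ‖a * p‖ < 1 := by
    rw [norm_mul]; exact mul_lt_one_of_nonneg_of_lt_one_right ha (norm_nonneg _) hp
  rw [← tsum_mul_left]
  refine tsum_congr fun n => ?_
  have h1 : qPoch (-(a * p)) p n ≠ 0 := qPoch_ne_zero (by rwa [norm_neg]) hp n
  have h2 := qPoch_ne_zero hp hp n
  have h3 : (n + 1).choose 2 = n + n.choose 2 := by
    rw [Nat.choose_succ_succ' n 1, Nat.choose_one_right]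
  rw [qPochInf_eq_qPoch_mul _ hp n, neg_mul,
    qPochInf_neg_eq_tsum (norm_mul_pow_le_one hap.le hp n) hp]
  trans (b * p) ^ n * eulerCoeff p n * ∑' m, (a * p * p ^ n) ^ m * eulerCoeff p m
  · rw [eulerCoeff, h3, pow_add]
    field_simp
    ring
  · rw [← tsum_mul_left]
    refine tsum_congr fun m => ?_
    rw [mul_pow (a * p), ← pow_mul]
    ring

lemma qPochInf_mul_tsum_comm {a b p : ℂ} (ha : ‖a‖ ≤ 1) (hb : ‖b‖ ≤ 1) (hp : ‖p‖ < 1) :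
    qPochInf (-(a * p)) p *
        ∑' n : ℕ, b ^ n * p ^ (n + 1).choose 2 / (qPoch p p n * qPoch (-(a * p)) p n) =
      qPochInf (-(b * p)) p *
        ∑' n : ℕ, a ^ n * p ^ (n + 1).choose 2 / (qPoch p p n * qPoch (-(b * p)) p n) := by
  have hap : ‖a * p‖ ≤ 1 := by simpa using norm_mul_pow_le_one ha hp 1
  have hbp : ‖b * p‖ ≤ 1 := by simpa using norm_mul_pow_le_one hb hp 1
  have hs : Summable (Function.uncurry fun n m : ℕ => (b * p) ^ n * (a * p) ^ m * p ^ (n * m) *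
      (eulerCoeff p n * eulerCoeff p m)) := by
    have h := summable_norm_eulerCoeff hp
    refine .of_norm_bounded (h.mul_norm h) fun x => ?_
    simp only [Function.uncurry, mul_assoc ((b * p) ^ x.1), mul_assoc ((a * p) ^ x.2)]
    exact (norm_pow_mul_le hbp _ _).trans <| (norm_pow_mul_le hap _ _).trans <|
      norm_pow_mul_le hp.le _ _
  rw [qPochInf_mul_tsum_eq ha hp, qPochInf_mul_tsum_eq hb hp, ← hs.tsum_comm]
  refine tsum_congr fun n => tsum_congr fun m => ?_
  rw [mul_comm m n]
  ring

/-- for integers `0 < r < s < k` and `|q| < 1`,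
`(−q^{r+k}; q^k)_∞ ∑_{n≥0} q^{sn} q^{kn(n+1)/2}/((q^k; q^k)_n (−q^{r+k}; q^k)_n)
  = (−q^{s+k}; q^k)_∞ ∑_{n≥0} q^{rn} q^{kn(n+1)/2}/((q^k; q^k)_n (−q^{s+k}; q^k)_n)`. -/
theorem restricted_entry_1_4_17 (r s k : ℕ) (hr : 0 < r) (hrs : r < s) (hsk : s < k)
    (q : ℂ) (hq : ‖q‖ < 1) :
    qPochInf (-q ^ (r + k)) (q ^ k) *
        ∑' n : ℕ, q ^ (s * n) * q ^ (k * (n * (n + 1) / 2)) /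
          (qPoch (q ^ k) (q ^ k) n * qPoch (-q ^ (r + k)) (q ^ k) n) =
      qPochInf (-q ^ (s + k)) (q ^ k) *
        ∑' n : ℕ, q ^ (r * n) * q ^ (k * (n * (n + 1) / 2)) /
          (qPoch (q ^ k) (q ^ k) n * qPoch (-q ^ (s + k)) (q ^ k) n) := by
  have hk : k ≠ 0 := by omega
  have hp : ‖q ^ k‖ < 1 := by rw [norm_pow]; exact pow_lt_one₀ (norm_nonneg _) hq hk
  have hle : ∀ t : ℕ, ‖q ^ t‖ ≤ 1 := fun t => by
    rw [norm_pow]; exact pow_le_one₀ (norm_nonneg _) hq.le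
  have hc : ∀ n : ℕ, n * (n + 1) / 2 = (n + 1).choose 2 := fun n => by
    rw [Nat.choose_two_right, Nat.add_sub_cancel, mul_comm]
  simp only [hc, pow_mul, pow_add]
  exact qPochInf_mul_tsum_comm (hle r) (hle s) hp
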